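/- arXiv:hep-th/0508048 — 2 statements merged into one kernel-verified Lean document; each statement's English description precedes it below -/
import Mathlib

section
/- Let 𝒜 be a finite-dimensional real inner product space equipped with an anticommutative bilinear product ∗ whose inner product is invariant. If the product is associative, i.e. (a∗b)∗c = a∗(b∗c) for all a, b, c ∈ 𝒜, then the product of any two elements is zero: a∗b = 0 for all a, b ∈ 𝒜 (the algebra is nilpotent of order two). -/
open scoped RealInnerProductSpace

/-- **Lemma 1 (spin-3 paper).** Let `𝒜` be a finite-dimensional real inner product
space equipped with an anticommutative bilinear product `∗` whose inner product is
invariant (`⟪a∗b, c⟫ = ⟪a, b∗c⟫`).  If the product is associative, then the product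
of any two elements is zero: the algebra is nilpotent of order two. -/
theorem anticommutative_invariant_associative_nilpotent_order_two
    {A : Type*} [NormedAddCommGroup A] [InnerProductSpace ℝ A] [FiniteDimensional ℝ A]
    (mul : A →ₗ[ℝ] A →ₗ[ℝ] A)
    (anticomm : ∀ a b : A, mul a b = - mul b a)
    (invariant : ∀ a b c : A, ⟪mul a b, c⟫ = ⟪a, mul b c⟫)
    (assoc : ∀ a b c : A, mul (mul a b) c = mul a (mul b c)) :
    ∀ a b : A, mul a b = 0 := by
  intro a b
  have : IsAddTorsionFree A := .of_isTorsionFree ℝ A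
  have hbb : mul b b = 0 := self_eq_neg.mp (anticomm b b)
  have hbab : mul b (mul a b) = 0 := by
    rw [anticomm a b, map_neg, ← assoc, hbb, map_zero, LinearMap.zero_apply, neg_zero]
  rw [← inner_self_eq_zero (𝕜 := ℝ), invariant, hbab, inner_zero_right]
end

section
/- For every gauge parameter λ (smooth, symmetric, η-traceless), the Fronsdal tensor of the pure gauge field (δ_λ h)_{μνρ} := ∂_μ λ_{νρ} + ∂_ν λ_{ρμ} + ∂_ρ λ_{μν} vanishes identically: F[δ_λ h]_{μνρ}(x) = 0 for all x ∈ ℝⁿ and all μ, ν, ρ. Consequently F[h + δ_λ h] = F[h] for every spin-3 field h. -/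
open MeasureTheory

noncomputable section

/-- Mostly-plus Minkowski metric `η_{μν} = diag(−1,+1,…,+1)` on `ℝⁿ`
(it coincides with its inverse `η^{μν}`). -/
def eta (n : ℕ) (μ ν : Fin n) : ℝ :=
  if μ = ν then (if (μ : ℕ) = 0 then -1 else 1) else 0

/-- Partial derivative `∂_μ` of a scalar function on `ℝⁿ`. -/
def pd {n : ℕ} (μ : Fin n) (f : (Fin n → ℝ) → ℝ) : (Fin n → ℝ) → ℝ :=
  fun x => fderiv ℝ f x (Pi.single μ 1)

/-- A rank-3 covariant tensor field on `ℝⁿ` (the type of spin-3 fields). -/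
abbrev Spin3 (n : ℕ) := (Fin n → ℝ) → Fin n → Fin n → Fin n → ℝ

/-- Trace `h_μ := η^{νρ} h_{μνρ}`. -/
def trH {n : ℕ} (h : Spin3 n) (x : Fin n → ℝ) (μ : Fin n) : ℝ :=
  ∑ ν, ∑ ρ, eta n ν ρ * h x μ ν ρ

/-- Fronsdal tensor
`F_{μνρ} := □h_{μνρ} − ∂^σ(∂_μ h_{νρσ} + ∂_ν h_{ρμσ} + ∂_ρ h_{μνσ})
  + ∂_μ∂_ν h_ρ + ∂_ν∂_ρ h_μ + ∂_ρ∂_μ h_ν`. -/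
def fronsdal {n : ℕ} (h : Spin3 n) (x : Fin n → ℝ) (μ ν ρ : Fin n) : ℝ :=
  (∑ σ, ∑ τ, eta n σ τ * pd σ (pd τ (fun y => h y μ ν ρ)) x)
  - (∑ σ, ∑ τ, eta n σ τ *
      pd τ (fun y => pd μ (fun z => h z ν ρ σ) y + pd ν (fun z => h z ρ μ σ) y
        + pd ρ (fun z => h z μ ν σ) y) x)
  + pd μ (pd ν (fun z => trH h z ρ)) x
  + pd ν (pd ρ (fun z => trH h z μ)) x
  + pd ρ (pd μ (fun z => trH h z ν)) x

/-- Trace of the Fronsdal tensor, `F_ρ := η^{μν} F_{μνρ}`. -/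
def trF {n : ℕ} (h : Spin3 n) (x : Fin n → ℝ) (ρ : Fin n) : ℝ :=
  ∑ μ, ∑ ν, eta n μ ν * fronsdal h x μ ν ρ

/-- Einstein tensor `G_{μνρ} := F_{μνρ} − (1/2)(η_{μν}F_ρ + η_{νρ}F_μ + η_{ρμ}F_ν)`. -/
def einstein {n : ℕ} (h : Spin3 n) (x : Fin n → ℝ) (μ ν ρ : Fin n) : ℝ :=
  fronsdal h x μ ν ρ
    - (1/2) * (eta n μ ν * trF h x ρ + eta n ν ρ * trF h x μ + eta n ρ μ * trF h x ν)

/-- Gauge transformation `(δ_λ h)_{μνρ} := ∂_μ λ_{νρ} + ∂_ν λ_{ρμ} + ∂_ρ λ_{μν}`. -/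
def gaugeTransform {n : ℕ} (lam : (Fin n → ℝ) → Fin n → Fin n → ℝ) : Spin3 n :=
  fun x μ ν ρ => pd μ (fun y => lam y ν ρ) x + pd ν (fun y => lam y ρ μ) x
    + pd ρ (fun y => lam y μ ν) x

/-- Curvature tensor `K_{αμ|βν|γρ}`: the antisymmetrization of `∂_α∂_β∂_γ h_{μνρ}`
in each of the index pairs `(α,μ)`, `(β,ν)`, `(γ,ρ)`. -/
def curvature {n : ℕ} (h : Spin3 n) (x : Fin n → ℝ) (α μ β ν γ ρ : Fin n) : ℝ :=
  pd α (pd β (pd γ (fun y => h y μ ν ρ))) x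
  - pd μ (pd β (pd γ (fun y => h y α ν ρ))) x
  - pd α (pd ν (pd γ (fun y => h y μ β ρ))) x
  - pd α (pd β (pd ρ (fun y => h y μ ν γ))) x
  + pd μ (pd ν (pd γ (fun y => h y α β ρ))) x
  + pd μ (pd β (pd ρ (fun y => h y α ν γ))) x
  + pd α (pd ν (pd ρ (fun y => h y μ β γ))) x
  - pd μ (pd ν (pd ρ (fun y => h y α β γ))) x

/-- The free Fronsdal Lagrangian density for a single spin-3 field (all
contractions performed with the Minkowski metric `η`). -/
def lag {n : ℕ} (h : Spin3 n) (x : Fin n → ℝ) : ℝ :=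
  -(1/2) * (∑ σ, ∑ τ, ∑ μ, ∑ μ', ∑ ν, ∑ ν', ∑ ρ, ∑ ρ',
      eta n σ τ * eta n μ μ' * eta n ν ν' * eta n ρ ρ' *
        pd σ (fun y => h y μ ν ρ) x * pd τ (fun y => h y μ' ν' ρ') x)
  + (3/2) * (∑ μ, ∑ μ', ∑ ν, ∑ ν', ∑ ρ, ∑ ρ', ∑ σ, ∑ σ',
      eta n μ μ' * eta n ν ν' * eta n ρ ρ' * eta n σ σ' *
        pd μ' (fun y => h y μ ρ σ) x * pd ν (fun y => h y ν' ρ' σ') x)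
  + (3/2) * (∑ μ, ∑ μ', ∑ ν, ∑ ν',
      eta n μ μ' * eta n ν ν' * pd μ (fun y => trH h y ν) x * pd μ' (fun y => trH h y ν') x)
  + (3/4) * (∑ μ, ∑ μ', ∑ ν, ∑ ν',
      eta n μ μ' * eta n ν ν' * pd μ (fun y => trH h y μ') x * pd ν (fun y => trH h y ν') x)
  - 3 * (∑ μ, ∑ μ', ∑ ν, ∑ ν', ∑ ρ, ∑ ρ',
      eta n μ μ' * eta n ν ν' * eta n ρ ρ' *
        pd μ (fun y => trH h y ν) x * pd ρ (fun y => h y ρ' μ' ν') x)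

/-- The free spin-3 (Fronsdal) action for a single field. -/
def action {n : ℕ} (h : Spin3 n) : ℝ := ∫ x : Fin n → ℝ, lag h x

theorem sum_eta_mul {n : ℕ} (f : Fin n → Fin n → ℝ) :
    ∑ μ, ∑ ν, eta n μ ν * f μ ν = ∑ μ, eta n μ μ * f μ μ := by
  refine Finset.sum_congr rfl fun μ _ => Finset.sum_eq_single μ (fun ν _ hν => ?_) (by simp)
  simp [eta, hν.symm]

theorem contDiff_pd {n : ℕ} {f : (Fin n → ℝ) → ℝ} (hf : ContDiff ℝ (⊤ : ℕ∞) f) (μ : Fin n) :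
    ContDiff ℝ (⊤ : ℕ∞) (pd μ f) :=
  (hf.fderiv_right (m := (⊤ : ℕ∞)) le_rfl).clm_apply contDiff_const

theorem pd_add {n : ℕ} {f g : (Fin n → ℝ) → ℝ} (hf : ContDiff ℝ (⊤ : ℕ∞) f)
    (hg : ContDiff ℝ (⊤ : ℕ∞) g) (μ : Fin n) :
    pd μ (fun x => f x + g x) = fun x => pd μ f x + pd μ g x := by
  ext x
  simp only [pd]
  rw [fderiv_fun_add (hf.differentiable (by simp) x) (hg.differentiable (by simp) x)]
  rfl

theorem pd_sum_mul {n : ℕ} {ι : Type*} [Fintype ι] (c : ι → ℝ) {f : ι → (Fin n → ℝ) → ℝ}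
    (hf : ∀ i, ContDiff ℝ (⊤ : ℕ∞) (f i)) (μ : Fin n) :
    pd μ (fun x => ∑ i, c i * f i x) = fun x => ∑ i, c i * pd μ (f i) x := by
  ext x
  have hd : ∀ i, DifferentiableAt ℝ (f i) x := fun i => (hf i).differentiable (by simp) x
  simp only [pd]
  rw [fderiv_fun_sum fun i _ => (hd i).const_mul (c i)]
  simp [fderiv_const_mul (hd _)]

theorem pd_zero {n : ℕ} (μ : Fin n) : pd μ (fun _ => 0) = fun _ => 0 := by
  ext x
  simp [pd]

theorem pd_comm {n : ℕ} {f : (Fin n → ℝ) → ℝ} (hf : ContDiff ℝ (⊤ : ℕ∞) f) (μ ν : Fin n) :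
    pd μ (pd ν f) = pd ν (pd μ f) := by
  ext x
  have hd : DifferentiableAt ℝ (fderiv ℝ f) x :=
    (hf.fderiv_right (m := (⊤ : ℕ∞)) le_rfl).differentiable (by simp) x
  have hs : IsSymmSndFDerivAt ℝ f x :=
    hf.contDiffAt.isSymmSndFDerivAt (by
      simpa using WithTop.coe_le_coe.2 (le_top : (2 : ℕ∞) ≤ ⊤))
  have key : ∀ α β : Fin n, pd α (pd β f) x
      = fderiv ℝ (fderiv ℝ f) x (Pi.single α 1) (Pi.single β 1) := fun α β => by
    change fderiv ℝ (fun y => fderiv ℝ f y (Pi.single β 1)) x (Pi.single α 1) = _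
    rw [fderiv_clm_apply hd (differentiableAt_const _)]
    simp
  rw [key, key]
  exact hs _ _

theorem contDiff_gaugeTransform {n : ℕ} {lam : (Fin n → ℝ) → Fin n → Fin n → ℝ}
    (hl : ∀ μ ν : Fin n, ContDiff ℝ (⊤ : ℕ∞) fun x => lam x μ ν) (μ ν ρ : Fin n) :
    ContDiff ℝ (⊤ : ℕ∞) fun x => gaugeTransform lam x μ ν ρ :=
  ((contDiff_pd (hl _ _) _).add (contDiff_pd (hl _ _) _)).add (contDiff_pd (hl _ _) _)

/-- The Fronsdal tensor of a smooth field, fully expanded in second derivatives of components. -/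
theorem fronsdal_eq_sum {n : ℕ} {h : Spin3 n}
    (hh : ∀ μ ν ρ : Fin n, ContDiff ℝ (⊤ : ℕ∞) fun x => h x μ ν ρ)
    (x : Fin n → ℝ) (μ ν ρ : Fin n) :
    fronsdal h x μ ν ρ = ∑ σ, eta n σ σ * (pd σ (pd σ fun y => h y μ ν ρ) x
      - (pd σ (pd μ fun y => h y ν ρ σ) x + pd σ (pd ν fun y => h y ρ μ σ) x
        + pd σ (pd ρ fun y => h y μ ν σ) x)
      + pd μ (pd ν fun y => h y ρ σ σ) x + pd ν (pd ρ fun y => h y μ σ σ) x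
      + pd ρ (pd μ fun y => h y ν σ σ) x) := by
  have tr : ∀ α β γ : Fin n, pd α (pd β fun z => trH h z γ) x
      = ∑ σ, eta n σ σ * pd α (pd β fun y => h y γ σ σ) x := fun α β γ => by
    simp only [trH, sum_eta_mul]
    rw [pd_sum_mul _ fun σ => hh γ σ σ, pd_sum_mul _ fun σ => contDiff_pd (hh γ σ σ) β]
  have div : ∀ σ, pd σ (fun y => pd μ (fun z => h z ν ρ σ) y + pd ν (fun z => h z ρ μ σ) y
        + pd ρ (fun z => h z μ ν σ) y) x
      = pd σ (pd μ fun y => h y ν ρ σ) x + pd σ (pd ν fun y => h y ρ μ σ) x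
        + pd σ (pd ρ fun y => h y μ ν σ) x := fun σ => by
    have h₁ := contDiff_pd (hh ν ρ σ) μ
    have h₂ := contDiff_pd (hh ρ μ σ) ν
    rw [pd_add (h₁.add h₂) (contDiff_pd (hh μ ν σ) ρ), pd_add h₁ h₂]
  simp only [fronsdal, sum_eta_mul, tr, div]
  rw [← Finset.sum_sub_distrib, ← Finset.sum_add_distrib, ← Finset.sum_add_distrib,
    ← Finset.sum_add_distrib]
  exact Finset.sum_congr rfl fun σ _ => by ring

theorem fronsdal_add {n : ℕ} {h k : Spin3 n}
    (hh : ∀ μ ν ρ : Fin n, ContDiff ℝ (⊤ : ℕ∞) fun x => h x μ ν ρ)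
    (hk : ∀ μ ν ρ : Fin n, ContDiff ℝ (⊤ : ℕ∞) fun x => k x μ ν ρ)
    (x : Fin n → ℝ) (μ ν ρ : Fin n) :
    fronsdal (fun y α β γ => h y α β γ + k y α β γ) x μ ν ρ
      = fronsdal h x μ ν ρ + fronsdal k x μ ν ρ := by
  have add : ∀ a b α β γ : Fin n, pd a (pd b fun y => h y α β γ + k y α β γ) x
      = pd a (pd b fun y => h y α β γ) x + pd a (pd b fun y => k y α β γ) x :=
    fun a b α β γ => by
      rw [pd_add (hh α β γ) (hk α β γ),
        pd_add (contDiff_pd (hh α β γ) b) (contDiff_pd (hk α β γ) b)]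
  rw [fronsdal_eq_sum hh, fronsdal_eq_sum hk,
    fronsdal_eq_sum (fun α β γ => (hh α β γ).add (hk α β γ)), ← Finset.sum_add_distrib]
  refine Finset.sum_congr rfl fun σ _ => ?_
  simp only [add]
  ring

/-- The gauge variation of the Fronsdal tensor is three times the third gradient of the trace of
the parameter. -/
theorem fronsdal_gaugeTransform {n : ℕ} {lam : (Fin n → ℝ) → Fin n → Fin n → ℝ}
    (hl : ∀ μ ν : Fin n, ContDiff ℝ (⊤ : ℕ∞) fun x => lam x μ ν)
    (hsym : ∀ x μ ν, lam x μ ν = lam x ν μ) (x : Fin n → ℝ) (μ ν ρ : Fin n) :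
    fronsdal (gaugeTransform lam) x μ ν ρ
      = 3 * pd μ (pd ν (pd ρ fun y => ∑ α, ∑ β, eta n α β * lam y α β)) x := by
  have expand : ∀ a b α β γ : Fin n, pd a (pd b fun y => gaugeTransform lam y α β γ) x
      = pd a (pd b (pd α fun y => lam y β γ)) x + pd a (pd b (pd β fun y => lam y γ α)) x
        + pd a (pd b (pd γ fun y => lam y α β)) x := fun a b α β γ => by
    have h₁ := contDiff_pd (hl β γ) α
    have h₂ := contDiff_pd (hl γ α) β
    have h₃ := contDiff_pd (hl α β) γ
    simp only [gaugeTransform]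
    rw [pd_add (h₁.add h₂) h₃, pd_add h₁ h₂,
      pd_add ((contDiff_pd h₁ b).add (contDiff_pd h₂ b)) (contDiff_pd h₃ b),
      pd_add (contDiff_pd h₁ b) (contDiff_pd h₂ b)]
  have swap : ∀ α β : Fin n, (fun y => lam y α β) = fun y => lam y β α :=
    fun α β => funext fun y => hsym y α β
  have outer : ∀ a b c α β : Fin n, pd a (pd b (pd c fun y => lam y α β)) x
      = pd b (pd a (pd c fun y => lam y α β)) x :=
    fun a b c α β => congrFun (pd_comm (contDiff_pd (hl α β) c) a b) x
  have inner : ∀ a b c α β : Fin n, pd a (pd b (pd c fun y => lam y α β)) x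
      = pd a (pd c (pd b fun y => lam y α β)) x :=
    fun a b c α β => by rw [pd_comm (hl α β) b c]
  rw [fronsdal_eq_sum (contDiff_gaugeTransform hl)]
  simp only [sum_eta_mul]
  rw [pd_sum_mul _ fun σ => hl σ σ, pd_sum_mul _ fun σ => contDiff_pd (hl σ σ) ρ,
    pd_sum_mul _ fun σ => contDiff_pd (contDiff_pd (hl σ σ) ρ) ν, Finset.mul_sum]
  refine Finset.sum_congr rfl fun σ _ => ?_
  simp only [expand]
  simp only [swap σ μ, swap σ ν, swap σ ρ, swap ρ μ, inner σ μ σ, inner σ ν σ, inner σ ρ σ,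
    inner μ ν σ, inner ν ρ σ, inner ρ μ σ, outer μ σ, outer ν σ, outer ρ σ, inner σ ν μ,
    inner σ ρ ν, inner σ ρ μ, inner ν ρ μ, outer ν μ ρ, outer ρ μ ν, inner μ ρ ν]
  ring

/-- **Gauge invariance of the Fronsdal tensor.**  For every gauge parameter `λ`
(smooth, symmetric, `η`-traceless) the Fronsdal tensor of the pure gauge field
`δ_λ h` vanishes identically; consequently `F[h + δ_λ h] = F[h]` for every
spin-3 field `h`. -/
theorem fronsdal_gauge_invariant (n : ℕ) (hn : 1 ≤ n)
    (lam : (Fin n → ℝ) → Fin n → Fin n → ℝ)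
    (lsmooth : ∀ μ ν : Fin n, ContDiff ℝ (⊤ : ℕ∞) fun x => lam x μ ν)
    (lsym : ∀ x μ ν, lam x μ ν = lam x ν μ)
    (ltraceless : ∀ x, ∑ μ, ∑ ν, eta n μ ν * lam x μ ν = 0) :
    (∀ x μ ν ρ, fronsdal (gaugeTransform lam) x μ ν ρ = 0) ∧
    (∀ h : Spin3 n,
      (∀ μ ν ρ : Fin n, ContDiff ℝ (⊤ : ℕ∞) fun x => h x μ ν ρ) →
      (∀ x μ ν ρ, h x μ ν ρ = h x ν μ ρ) →
      (∀ x μ ν ρ, h x μ ν ρ = h x μ ρ ν) →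
      ∀ x μ ν ρ,
        fronsdal (fun y α β γ => h y α β γ + gaugeTransform lam y α β γ) x μ ν ρ
          = fronsdal h x μ ν ρ) := by
  have gauge : ∀ x μ ν ρ, fronsdal (gaugeTransform lam) x μ ν ρ = 0 := fun x μ ν ρ => by
    rw [fronsdal_gaugeTransform lsmooth lsym]
    simp only [ltraceless, pd_zero, mul_zero]
  refine ⟨gauge, fun h hs _ _ x μ ν ρ => ?_⟩
  rw [fronsdal_add hs (contDiff_gaugeTransform lsmooth), gauge, add_zero]
end
end
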